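/- Soundness of the reduction game for ∀^k properties (Theorem 2): Assume the lifted initial set {c ∈ C^k | c_i ∈ init for all 1 ≤ i ≤ k}, each lifted observation set Ξ_i = {c ∈ C^k | c_i ∈ ξ_i} (1 ≤ i ≤ k), and every edge label of the automaton A are expressible in the abstraction. If player SAFE has a winning positional strategy in the safety game G^∀, then for all traces t_1, …, t_k of the transition system such that ξ_i is a valid observation on t_i for each i, the infinite word w over C^k defined by w(j) = (t_1|ξ_1(j), …, t_k|ξ_k(j)) is accepted by A. -/

import Mathlib

/-- A trace of the transition system `(init, step)`. -/
def IsTrace {C : Type*} (init : Set C) (step : Set (C × C)) (t : ℕ → C) : Prop :=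
  t 0 ∈ init ∧ ∀ i, (t i, t (i + 1)) ∈ step

/-- `ξ` is a valid observation on `t` if `t i ∈ ξ` for infinitely many `i`. -/
def ValidObs {S : Type*} (ξ : Set S) (t : ℕ → S) : Prop :=
  {i : ℕ | t i ∈ ξ}.Infinite

/-- The filtered trace `t|ξ`: its `i`-th value is `t j` where `j` is the `i`-th index
(in increasing order) with `t j ∈ ξ`. -/
noncomputable def filterTrace {S : Type*} (t : ℕ → S) (ξ : Set S) : ℕ → S :=
  fun i => t (Nat.nth (fun j => t j ∈ ξ) i)

/-- The concretization of an abstract state `s ∈ 𝔹ⁿ` w.r.t. the predicates `p`. -/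
def conc {D : Type*} {n : ℕ} (p : Fin n → Set D) (s : Fin n → Bool) : Set D :=
  {d | ∀ i, d ∈ p i ↔ s i = true}

/-- A set is expressible in the abstraction if membership only depends on the
truth values of the predicates `p`. -/
def Expressible {D : Type*} {n : ℕ} (p : Fin n → Set D) (Y : Set D) : Prop :=
  ∀ d d', (∀ i, d ∈ p i ↔ d' ∈ p i) → (d ∈ Y ↔ d' ∈ Y)

/-- `c'` is an `M`-step from `c`: every copy in the scheduling `M` takes a `step`,
all other copies stay put. -/
def MStep {C : Type*} {k : ℕ} (step : Set (C × C)) (M : Set (Fin k)) (c c' : Fin k → C) : Prop :=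
  ∀ i, (i ∈ M → (c i, c' i) ∈ step) ∧ (i ∉ M → c' i = c i)

/-- `s'` is an `M`-successor of `s` (written `s →_M s'`). -/
def MSucc {C : Type*} {k n : ℕ} (p : Fin n → Set (Fin k → C)) (step : Set (C × C))
    (M : Set (Fin k)) (s s' : Fin n → Bool) : Prop :=
  ∃ c ∈ conc p s, ∃ c', MStep step M c c' ∧ c' ∈ conc p s'

/-- A deterministic symbolic safety automaton over the alphabet `σ`: a finite set of
states `Q` with initial state `q0`, a finite set of edges `(q, E, q')` whose labels `E`
are sets of letters, and bad states `Bad`, such that for every state `q` and letter `a`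
there is exactly one edge from `q` whose label contains `a`. -/
structure DSA (σ : Type*) where
  Q : Type*
  finQ : Finite Q
  q0 : Q
  edges : Set (Q × Set σ × Q)
  finEdges : edges.Finite
  Bad : Set Q
  det : ∀ (q : Q) (a : σ), ∃! e : Q × Set σ × Q, e ∈ edges ∧ e.1 = q ∧ a ∈ e.2.1

/-- `r` is the run of `A` on the infinite word `w`. -/
def IsRun {σ : Type*} (A : DSA σ) (w : ℕ → σ) (r : ℕ → A.Q) : Prop :=
  r 0 = A.q0 ∧ ∀ j, ∃ E, (r j, E, r (j + 1)) ∈ A.edges ∧ w j ∈ E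

/-- `w` is accepted by `A` if its run never visits a bad state. -/
def Accepted {σ : Type*} (A : DSA σ) (w : ℕ → σ) : Prop :=
  ∀ r : ℕ → A.Q, IsRun A w r → ∀ j, r j ∉ A.Bad

/-- `obsAt p ξ s i` holds iff copy `i` is at an observation point in the abstract
state `s`, i.e. `⟦s⟧` intersects the lifted observation set `Ξ_i = {c | c i ∈ ξ i}`. -/
def obsAt {C : Type*} {k n : ℕ} (p : Fin n → Set (Fin k → C)) (ξ : Fin k → Set C)
    (s : Fin n → Bool) (i : Fin k) : Prop :=
  (conc p s ∩ {c : Fin k → C | c i ∈ ξ i}).Nonempty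

/-- `σ` is a winning positional strategy for player SAFE in the safety game with edge
relation `Edge`, initial states `Init`, bad states `Bad` and SAFE-owned states
`IsSafeSt`: `σ` picks, at every SAFE-state, a transition successor, and no (prefix of a)
play starting in an initial state, following the edges, and taking the prescribed move
at every SAFE-state ever visits a bad state. -/
def GWinning {St : Type*} (Edge : St → St → Prop) (Init Bad IsSafeSt : St → Prop)
    (σ : St → St) : Prop :=
  (∀ st, IsSafeSt st → Edge st (σ st)) ∧
  ∀ (pl : ℕ → St) (m : ℕ), Init (pl 0) →
    (∀ i < m, Edge (pl i) (pl (i + 1)) ∧ (IsSafeSt (pl i) → pl (i + 1) = σ (pl i))) →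
    ¬ Bad (pl m)

/-- Game states of the reduction game `G^∀`: SAFE-states `(ŝ, q, b)` and
REACH-states `(ŝ, q, b, M)`. -/
inductive GS (n k : ℕ) (Q : Type*) where
  | safe (s : Fin n → Bool) (q : Q) (b : Fin k → Bool)
  | reach (s : Fin n → Bool) (q : Q) (b : Fin k → Bool) (M : Set (Fin k))

/-- SAFE-owned states of `G^∀`. -/
def GIsSafe {n k : ℕ} {Q : Type*} : GS n k Q → Prop
  | .safe _ _ _ => True
  | .reach _ _ _ _ => False

/-- Initial states of `G^∀`: all `(ŝ, q₀, ⊤^k)` with `⟦ŝ⟧` intersecting the lifted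
initial set. -/
def GInit {C : Type*} {n k : ℕ} (p : Fin n → Set (Fin k → C)) (init : Set C)
    (Aut : DSA (Fin k → C)) (st : GS n k Aut.Q) : Prop :=
  ∃ s : Fin n → Bool, st = GS.safe s Aut.q0 (fun _ => true) ∧
    (conc p s ∩ {c : Fin k → C | ∀ i, c i ∈ init}).Nonempty

/-- Bad states of `G^∀`: those whose automaton component is bad. -/
def GBad {n k : ℕ} {Q : Type*} (B : Set Q) : GS n k Q → Prop
  | .safe _ q _ => q ∈ B
  | .reach _ q _ _ => q ∈ B

/-- Transitions of the reduction game `G^∀`: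
(1) SAFE picks a nonempty scheduling `M` only containing copies that have not moved
since the last automaton step or are not at an observation point;
(2) if all copies are at observation points and all have moved, the automaton takes a
step (along the unique edge whose label intersects `⟦ŝ⟧`) and the move-marker is reset;
(3) REACH picks any abstract `M`-successor, marking the scheduled copies as moved. -/
inductive GEdge {C : Type*} {k n : ℕ} (p : Fin n → Set (Fin k → C)) (step : Set (C × C))
    (ξ : Fin k → Set C) (Aut : DSA (Fin k → C)) : GS n k Aut.Q → GS n k Aut.Q → Prop where
  | sched {s : Fin n → Bool} {q : Aut.Q} {b : Fin k → Bool} {M : Set (Fin k)} :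
      M.Nonempty →
      (∀ i ∈ M, b i = false ∨ ¬ obsAt p ξ s i) →
      GEdge p step ξ Aut (.safe s q b) (.reach s q b M)
  | auto {s : Fin n → Bool} {q q' : Aut.Q} {E : Set (Fin k → C)} :
      (∀ i, obsAt p ξ s i) →
      (q, E, q') ∈ Aut.edges →
      (conc p s ∩ E).Nonempty →
      GEdge p step ξ Aut (.safe s q (fun _ => true)) (.safe s q' (fun _ => false))
  | move {s s' : Fin n → Bool} {q : Aut.Q} {b b' : Fin k → Bool} {M : Set (Fin k)} :
      MSucc p step M s s' →
      (∀ i ∈ M, b' i = true) →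
      (∀ i ∉ M, b' i = b i) →
      GEdge p step ξ Aut (.reach s q b M) (.safe s' q b')

/-- A game state reached by some finite play compatible with the strategy `σ`. -/
def GReached {St : Type*} (Edge : St → St → Prop) (Init IsSafeSt : St → Prop)
    (σ : St → St) (st : St) : Prop :=
  ∃ (pl : ℕ → St) (m : ℕ), Init (pl 0) ∧
    (∀ i < m, Edge (pl i) (pl (i + 1)) ∧ (IsSafeSt (pl i) → pl (i + 1) = σ (pl i))) ∧
    pl m = st

theorem GReached.of_init {St : Type*} {Edge : St → St → Prop} {Init IsSafeSt : St → Prop}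
    {σ : St → St} {st : St} (h : Init st) : GReached Edge Init IsSafeSt σ st :=
  ⟨fun _ => st, 0, h, by simp, rfl⟩

theorem GReached.edge {St : Type*} {Edge : St → St → Prop} {Init IsSafeSt : St → Prop}
    {σ : St → St} {st st' : St} (h : GReached Edge Init IsSafeSt σ st)
    (hE : Edge st st') (hσ : IsSafeSt st → st' = σ st) :
    GReached Edge Init IsSafeSt σ st' := by
  obtain ⟨pl, m, h0, hstep, rfl⟩ := h
  refine ⟨fun i => if i ≤ m then pl i else st', m + 1, by simpa using h0, ?_, by simp⟩
  intro i hi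
  rcases Nat.lt_succ_iff_lt_or_eq.mp hi with h | rfl
  · have h1 : i ≤ m := h.le
    have h2 : i + 1 ≤ m := h
    simpa [h1, h2] using hstep i h
  · simpa using ⟨hE, hσ⟩

theorem GWinning.not_bad {St : Type*} {Edge : St → St → Prop} {Init Bad IsSafeSt : St → Prop}
    {σ : St → St} (h : GWinning Edge Init Bad IsSafeSt σ) {st : St}
    (hst : GReached Edge Init IsSafeSt σ st) : ¬ Bad st := by
  obtain ⟨pl, m, h0, hstep, rfl⟩ := hst
  exact h.2 pl m h0 hstep

open Classical in
/-- The abstract state whose concretization contains `d`. -/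
noncomputable def absState {D : Type*} {n : ℕ} (p : Fin n → Set D) (d : D) : Fin n → Bool :=
  fun i => decide (d ∈ p i)

theorem mem_conc_absState {D : Type*} {n : ℕ} (p : Fin n → Set D) (d : D) :
    d ∈ conc p (absState p d) := by
  intro i
  simp [absState]

theorem Expressible.conc_inter_nonempty_iff {D : Type*} {n : ℕ} {p : Fin n → Set D} {Y : Set D}
    (hY : Expressible p Y) (d : D) : (conc p (absState p d) ∩ Y).Nonempty ↔ d ∈ Y := by
  refine ⟨fun ⟨d', hd', hY'⟩ => ?_, fun h => ⟨d, mem_conc_absState p d, h⟩⟩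
  exact (hY d d' fun i => (mem_conc_absState p d i).trans (hd' i).symm).mpr hY'

theorem DSA.edge_target_unique {S : Type*} (A : DSA S) {q q₁ q₂ : A.Q} {E₁ E₂ : Set S} {a : S}
    (h₁ : (q, E₁, q₁) ∈ A.edges) (ha₁ : a ∈ E₁) (h₂ : (q, E₂, q₂) ∈ A.edges) (ha₂ : a ∈ E₂) :
    q₁ = q₂ := by
  have := (A.det q a).unique ⟨h₁, rfl, ha₁⟩ ⟨h₂, rfl, ha₂⟩
  simp only [Prod.mk.injEq] at this
  exact this.2.2

open Classical in
/-- The positions `pos` lie in round `j` of the automaton: marked copies have passed exactly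
`j` observation points, unmarked ones still sit at the observation point of index `j - 1`. -/
def InRound {C : Type*} {k : ℕ} (ξ : Fin k → Set C) (t : Fin k → ℕ → C) (j : ℕ)
    (pos : Fin k → ℕ) (b : Fin k → Bool) : Prop :=
  ∀ i, if b i then Nat.count (fun l => t i l ∈ ξ i) (pos i) = j
    else Nat.count (fun l => t i l ∈ ξ i) (pos i) + 1 = j ∧ t i (pos i) ∈ ξ i

open Classical in
/-- From any reached game state tracking the traces in round `j`, the play that follows the
strategy and the traces reaches round `j + 1`. -/
theorem exists_reached_next_round {C : Type*} {k n : ℕ}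
    {init : Set C} {step : Set (C × C)}
    {p : Fin n → Set (Fin k → C)} {ξ : Fin k → Set C} {Aut : DSA (Fin k → C)}
    (hobs_expr : ∀ i : Fin k, Expressible p {c : Fin k → C | c i ∈ ξ i})
    (hlabels : ∀ e ∈ Aut.edges, Expressible p e.2.1)
    {σ : GS n k Aut.Q → GS n k Aut.Q}
    (hσ : ∀ st, GIsSafe st → GEdge p step ξ Aut st (σ st))
    {t : Fin k → ℕ → C}
    (ht : ∀ i, IsTrace init step (t i))
    (hv : ∀ i, ValidObs (ξ i) (t i))
    {r : ℕ → Aut.Q} (hr : IsRun Aut (fun j i => filterTrace (t i) (ξ i) j) r) (j : ℕ)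
    (pos : Fin k → ℕ) (b : Fin k → Bool)
    (hreach : GReached (GEdge p step ξ Aut) (GInit p init Aut) GIsSafe σ
      (.safe (absState p fun i => t i (pos i)) (r j) b))
    (hround : InRound ξ t j pos b) :
    ∃ pos b, GReached (GEdge p step ξ Aut) (GInit p init Aut) GIsSafe σ
      (.safe (absState p fun i => t i (pos i)) (r (j + 1)) b) ∧ InRound ξ t (j + 1) pos b := by
  induction hN : ∑ i, (Nat.nth (fun l => t i l ∈ ξ i) j - pos i) using Nat.strong_induction_on
    generalizing pos b with
  | _ N ih =>
  have hobs : ∀ i, obsAt p ξ (absState p fun i => t i (pos i)) i ↔ t i (pos i) ∈ ξ i :=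
    fun i => (hobs_expr i).conc_inter_nonempty_iff _
  have hedge := hσ (.safe (absState p fun i => t i (pos i)) (r j) b) trivial
  generalize hst : σ (.safe (absState p fun i => t i (pos i)) (r j) b) = st at hedge
  have hreach' := hreach.edge hedge fun _ => hst.symm
  cases hedge with
  | @auto _ _ q' E hall hE hne =>
    have hcE := ((hlabels _ hE).conc_inter_nonempty_iff _).mp hne
    have hcount : ∀ i, Nat.count (fun l => t i l ∈ ξ i) (pos i) = j := fun i => by
      simpa using hround i
    have hw : (fun i => filterTrace (t i) (ξ i) j) = fun i => t i (pos i) := by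
      funext i
      have := Nat.nth_count (p := fun l => t i l ∈ ξ i) ((hobs i).mp (hall i))
      rw [hcount i] at this
      simp only [filterTrace, this]
    obtain ⟨E', hE', hwE'⟩ := hr.2 j
    simp only [hw] at hwE'
    obtain rfl := Aut.edge_target_unique hE hcE hE' hwE'
    refine ⟨pos, _, hreach', fun i => ?_⟩
    simpa [hcount i] using (hobs i).mp (hall i)
  | @sched _ _ _ M hM hsched =>
    let pos' : Fin k → ℕ := fun i => if i ∈ M then pos i + 1 else pos i
    let b' : Fin k → Bool := fun i => if i ∈ M then true else b i
    have hmove : GEdge p step ξ Aut (.reach (absState p fun i => t i (pos i)) (r j) b M)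
        (.safe (absState p fun i => t i (pos' i)) (r j) b') := by
      refine .move ⟨_, mem_conc_absState p _, _, fun i => ⟨fun hi => ?_, fun hi => ?_⟩,
        mem_conc_absState p _⟩ (fun i hi => by simp [b', hi]) (fun i hi => by simp [b', hi])
      · simpa [pos', hi] using (ht i).2 (pos i)
      · simp [pos', hi]
    have hcount : ∀ i ∈ M, Nat.count (fun l => t i l ∈ ξ i) (pos i + 1) = j := by
      intro i hi
      have h1 := hround i
      have h2 := hsched i hi
      rw [hobs] at h2
      rw [Nat.count_succ]
      cases hb : b i <;> simp_all
    have hlt : ∀ i ∈ M, pos i < Nat.nth (fun l => t i l ∈ ξ i) j := by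
      intro i hi
      have := Nat.le_nth_count (p := fun l => t i l ∈ ξ i) (hv i) (pos i + 1)
      rwa [hcount i hi] at this
    refine ih _ ?_ pos' b' (hreach'.edge hmove False.elim) (fun i => ?_) rfl
    · rw [← hN]
      obtain ⟨i, hi⟩ := hM
      refine Finset.sum_lt_sum (fun l _ => ?_) ⟨i, Finset.mem_univ i, ?_⟩
      · simp only [pos']
        split_ifs <;> omega
      · have := hlt i hi
        simp only [pos', hi, if_true]
        omega
    · by_cases hi : i ∈ M
      · simpa [pos', b', hi] using hcount i hi
      · simpa [pos', b', hi] using hround i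

/-- Theorem 2: soundness of the reduction game for `∀^k` properties.
If the lifted initial set, the lifted observation sets and all automaton edge labels
are expressible in the abstraction, and player SAFE has a winning positional strategy
in `G^∀`, then for all traces `t 0, …, t (k-1)` of the transition system on which the
respective observation sets are valid, the zipped word of filtered traces is accepted
by the automaton. -/
theorem reduction_game_soundness {C : Type*} {k n : ℕ} (hk : 1 ≤ k)
    (init : Set C) (step : Set (C × C))
    (p : Fin n → Set (Fin k → C)) (ξ : Fin k → Set C)
    (Aut : DSA (Fin k → C))
    (hinit_expr : Expressible p {c : Fin k → C | ∀ i, c i ∈ init})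
    (hobs_expr : ∀ i : Fin k, Expressible p {c : Fin k → C | c i ∈ ξ i})
    (hlabels : ∀ e ∈ Aut.edges, Expressible p e.2.1)
    (σ : GS n k Aut.Q → GS n k Aut.Q)
    (hwin : GWinning (GEdge p step ξ Aut) (GInit p init Aut) (GBad Aut.Bad) GIsSafe σ)
    (t : Fin k → ℕ → C)
    (ht : ∀ i, IsTrace init step (t i))
    (hv : ∀ i, ValidObs (ξ i) (t i)) :
    Accepted Aut (fun j => fun i => filterTrace (t i) (ξ i) j) := by
  intro r hr j
  have hreach : ∃ pos b, GReached (GEdge p step ξ Aut) (GInit p init Aut) GIsSafe σ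
      (.safe (absState p fun i => t i (pos i)) (r j) b) ∧ InRound ξ t j pos b := by
    induction j with
    | zero =>
      refine ⟨fun _ => 0, fun _ => true, .of_init ⟨_, by rw [hr.1], ?_⟩, fun i => by simp⟩
      exact (hinit_expr.conc_inter_nonempty_iff _).mpr fun i => (ht i).1
    | succ j ih =>
      obtain ⟨pos, b, hreach, hround⟩ := ih
      exact exists_reached_next_round hobs_expr hlabels hwin.1 ht hv hr j pos b hreach hround
  obtain ⟨pos, b, hreach, -⟩ := hreach
  exact hwin.not_bad hreach
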